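/- Every connected finite graph whose adjacency matrix has all eigenvalues of absolute value strictly less than 2 is a simply-laced Dynkin diagram, i.e., of type A_m (m ≥ 1), D_m (m ≥ 4), E_6, E_7 or E_8. -/

import Mathlib

/-- The path graph on `m` vertices (type `A_m` Dynkin diagram). -/
def pathG (m : ℕ) : SimpleGraph (Fin m) :=
  SimpleGraph.fromRel (fun i j => (j : ℕ) = (i : ℕ) + 1)

/-- The graph on `m` vertices obtained from the path on the first `m − 1`
vertices by attaching the last vertex to the vertex with index `b`. -/
def branchG (m b : ℕ) : SimpleGraph (Fin m) :=
  SimpleGraph.fromRel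
    (fun i j => ((j : ℕ) = (i : ℕ) + 1 ∧ (j : ℕ) ≤ m - 2) ∨ ((i : ℕ) = b ∧ (j : ℕ) = m - 1))

/-- The type `D_m` Dynkin diagram: the path on `m − 1` vertices with an extra
vertex attached to the second-to-last vertex. -/
def DynkinD (m : ℕ) : SimpleGraph (Fin m) := branchG m (m - 3)

/-- The type `E_n` Dynkin diagrams (`n = 6, 7, 8`): the path on `n − 1` vertices
with an extra vertex attached to the third vertex from one end. -/
def DynkinE (n : ℕ) : SimpleGraph (Fin n) := branchG n 2

namespace SimpleGraph

variable {V : Type*} {G : SimpleGraph V}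

/-- A nonnegative nonzero vector that is subharmonic on its support forces an adjacency
eigenvalue of absolute value at least `2`. -/
theorem false_of_two_mul_le_sum_neighborFinset [Fintype V] [DecidableEq V] [DecidableRel G.Adj]
    (heig : ∀ α : ℝ, (∃ v : V → ℝ, v ≠ 0 ∧ (G.adjMatrix ℝ).mulVec v = α • v) → |α| < 2)
    (f : V → ℝ) (hf : f ≠ 0) (hf0 : ∀ v, 0 ≤ f v)
    (h : ∀ v, f v ≠ 0 → 2 * f v ≤ ∑ w ∈ G.neighborFinset v, f w) : False := by
  have hA : (G.adjMatrix ℝ).IsHermitian := by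
    rw [Matrix.IsHermitian, Matrix.conjTranspose_eq_transpose_of_trivial]
    exact G.isSymm_adjMatrix
  have hB : ((2 : ℝ) • (1 : Matrix V V ℝ) - G.adjMatrix ℝ).IsHermitian := by
    refine Matrix.IsHermitian.sub ?_ hA
    simp [Matrix.IsHermitian]
  have hpos := (hB.posDef_iff_eigenvalues_pos).2 fun i => by
    have hv := hB.mulVec_eigenvectorBasis i
    have hne : (hB.eigenvectorBasis i : V → ℝ) ≠ 0 := fun h0 =>
      hB.eigenvectorBasis.toBasis.ne_zero i (by ext j; simpa using congrFun h0 j)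
    have := heig (2 - hB.eigenvalues i) ⟨_, hne, by
      rw [Matrix.sub_mulVec, Matrix.smul_mulVec, Matrix.one_mulVec] at hv
      rw [sub_smul, ← hv]; abel⟩
    linarith [(abs_lt.1 this).2]
  have hq := hpos.dotProduct_mulVec_pos hf
  refine hq.not_ge (Finset.sum_nonpos fun v _ => ?_)
  simp only [Matrix.sub_mulVec, Matrix.smul_mulVec, Matrix.one_mulVec, star_trivial,
    Pi.sub_apply, Pi.smul_apply, adjMatrix_mulVec_apply, smul_eq_mul]
  by_cases hv : f v = 0
  · simp [hv]
  · exact mul_nonpos_of_nonneg_of_nonpos (hf0 v) (by linarith [h v hv])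

/-- No injective sequence of vertices carries nonzero weights that are subharmonic on it. -/
def NoSubharmonicWeights (G : SimpleGraph V) : Prop :=
  ∀ (φ : ℕ → V) (S : Finset ℕ) (g : ℕ → ℕ), Set.InjOn φ S → (∃ a ∈ S, g a ≠ 0) →
    ¬ ∀ a ∈ S, ∃ N ⊆ S, (∀ b ∈ N, G.Adj (φ a) (φ b)) ∧ 2 * g a ≤ ∑ b ∈ N, g b

theorem noSubharmonicWeights_of_eigenvalues [Fintype V] [DecidableEq V] [DecidableRel G.Adj]
    (heig : ∀ α : ℝ, (∃ v : V → ℝ, v ≠ 0 ∧ (G.adjMatrix ℝ).mulVec v = α • v) → |α| < 2) :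
    G.NoSubharmonicWeights := by
  intro φ S g hφ hg h
  let f : V → ℝ := fun v => ∑ a ∈ S with φ a = v, (g a : ℝ)
  have hfφ : ∀ a ∈ S, f (φ a) = g a := fun a ha => by
    have : S.filter (fun b => φ b = φ a) = {a} := by
      ext b
      simp only [Finset.mem_filter, Finset.mem_singleton]
      exact ⟨fun hb => hφ hb.1 ha hb.2, by rintro rfl; exact ⟨ha, rfl⟩⟩
    simp [f, this]
  have hf0 : ∀ v, 0 ≤ f v := fun v => Finset.sum_nonneg fun a _ => Nat.cast_nonneg _
  refine false_of_two_mul_le_sum_neighborFinset heig f ?_ hf0 fun v hv => ?_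
  · obtain ⟨a, ha, hga⟩ := hg
    intro h0
    have := hfφ a ha
    rw [h0, Pi.zero_apply] at this
    exact hga (by exact_mod_cast this.symm)
  · obtain ⟨a, ha, -⟩ := Finset.exists_ne_zero_of_sum_ne_zero hv
    obtain ⟨haS, rfl⟩ := Finset.mem_filter.1 ha
    obtain ⟨N, hN, hadj, hle⟩ := h a haS
    calc 2 * f (φ a) = ((2 * g a : ℕ) : ℝ) := by rw [hfφ a haS]; push_cast; ring
      _ ≤ ((∑ b ∈ N, g b : ℕ) : ℝ) := by exact_mod_cast hle
      _ = ∑ b ∈ N, f (φ b) := by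
        push_cast
        exact Finset.sum_congr rfl fun b hb => (hfφ b (hN hb)).symm
      _ = ∑ w ∈ N.image φ, f w := by
        rw [Finset.sum_image fun x hx y hy hxy => hφ (hN hx) (hN hy) hxy]
      _ ≤ ∑ w ∈ G.neighborFinset (φ a), f w :=
        Finset.sum_le_sum_of_subset_of_nonneg
          (by
            intro w hw
            obtain ⟨b, hb, rfl⟩ := Finset.mem_image.1 hw
            simpa using hadj b hb)
          fun w _ _ => hf0 w

/-- The sequence `p` restricted to `0, …, n` is a path of length `n` in `G`. -/
def IsPathSeq (G : SimpleGraph V) (p : ℕ → V) (n : ℕ) : Prop :=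
  Set.InjOn p (Set.Iic n) ∧ ∀ k < n, G.Adj (p k) (p (k + 1))

namespace IsPathSeq

variable {p : ℕ → V} {n : ℕ}

theorem inj (hp : G.IsPathSeq p n) {a b : ℕ} (ha : a ≤ n) (hb : b ≤ n) (h : p a = p b) : a = b :=
  hp.1 ha hb h

theorem reverse (hp : G.IsPathSeq p n) : G.IsPathSeq (fun k => p (n - k)) n := by
  refine ⟨fun a ha b hb hab => ?_, fun k hk => ?_⟩
  · have := hp.inj (Nat.sub_le n a) (Nat.sub_le n b) hab
    simp only [Set.mem_Iic] at ha hb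
    omega
  · have := (hp.2 (n - (k + 1)) (by omega)).symm
    rwa [show n - (k + 1) + 1 = n - k by omega] at this

theorem cons (hp : G.IsPathSeq p n) {r : V} (hr : ∀ k ≤ n, p k ≠ r) (h : G.Adj r (p 0)) :
    G.IsPathSeq (fun k => Nat.casesOn k r p) (n + 1) := by
  refine ⟨fun a ha b hb hab => ?_, fun k hk => ?_⟩
  · simp only [Set.mem_Iic] at ha hb
    rcases a with _ | a <;> rcases b with _ | b
    · rfl
    · exact absurd hab.symm (hr b (by omega))
    · exact absurd hab (hr a (by omega))
    · rw [hp.inj (by omega) (by omega) hab]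
  · rcases k with _ | k
    · exact h
    · exact hp.2 k (by omega)

theorem update_zero (hp : G.IsPathSeq p n) {q : V} (hq : ∀ k ≤ n, p k ≠ q) (h : G.Adj q (p 1)) :
    G.IsPathSeq (Function.update p 0 q) n := by
  refine ⟨fun a ha b hb hab => ?_, fun k hk => ?_⟩
  · simp only [Set.mem_Iic] at ha hb
    rcases a with _ | a <;> rcases b with _ | b
    · rfl
    · exact absurd hab.symm (by simpa using hq _ hb)
    · exact absurd hab (by simpa using hq _ ha)
    · exact hp.inj ha hb (by simpa using hab)
  · rcases k with _ | k
    · simpa using h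
    · simpa using hp.2 _ hk

end IsPathSeq

theorem exists_isPathSeq_maximal [Fintype V] [Nonempty V] (G : SimpleGraph V) :
    ∃ p n, G.IsPathSeq p n ∧ ∀ p', ¬ G.IsPathSeq p' (n + 1) := by
  by_contra! hno
  have hall : ∀ n, ∃ p, G.IsPathSeq p n := by
    intro n
    induction n with
    | zero =>
      exact ⟨fun _ => Classical.arbitrary V, fun a ha b hb _ => by simp_all, by simp⟩
    | succ n ih =>
      obtain ⟨p, hp⟩ := ih
      exact hno p n hp
  obtain ⟨p, hp⟩ := hall (Fintype.card V)
  have := Finset.card_le_card_of_injOn (s := Finset.range (Fintype.card V + 1))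
    (t := Finset.univ) p (by simp) (fun a ha b hb h => hp.inj (by simp at ha; omega)
      (by simp at hb; omega) h)
  simp at this

theorem Connected.exists_adj_notMem (hG : G.Connected) {S : Set V} {u w : V} (hu : u ∈ S)
    (hw : w ∉ S) : ∃ x ∈ S, ∃ y ∉ S, G.Adj x y := by
  obtain ⟨W⟩ := hG.preconnected u w
  obtain ⟨d, -, h1, h2⟩ := W.exists_boundary_dart S hu hw
  exact ⟨_, h1, _, h2, d.adj⟩

/-- The sequence `p 0, …, p n` followed by `q`. -/
def snocSeq (p : ℕ → V) (n : ℕ) (q : V) (k : ℕ) : V := if k ≤ n then p k else q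

theorem snocSeq_of_le {p : ℕ → V} {n : ℕ} {q : V} {k : ℕ} (h : k ≤ n) :
    snocSeq p n q k = p k := if_pos h

@[simp] theorem snocSeq_succ {p : ℕ → V} {n : ℕ} {q : V} : snocSeq p n q (n + 1) = q :=
  if_neg (by omega)

theorem injOn_snocSeq {p : ℕ → V} {n : ℕ} {q : V} (hp : Set.InjOn p (Set.Iic n))
    (hq : ∀ k ≤ n, p k ≠ q) : Set.InjOn (snocSeq p n q) (Set.Iic (n + 1)) := by
  intro a ha b hb hab
  simp only [Set.mem_Iic] at ha hb
  unfold snocSeq at hab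
  split_ifs at hab with h1 h2 h2
  · exact hp h1 h2 hab
  · exact absurd hab (hq a h1)
  · exact absurd hab.symm (hq b h2)
  · omega

namespace NoSubharmonicWeights

variable {p : ℕ → V} {n i j : ℕ} {q r : V}

theorem not_adj_of_injOn (hG : G.NoSubharmonicWeights) (hij : i + 2 ≤ j)
    (hp : Set.InjOn p (Set.Icc i j)) (hadj : ∀ k, i ≤ k → k < j → G.Adj (p k) (p (k + 1))) :
    ¬ G.Adj (p i) (p j) := by
  intro h
  have hprev : ∀ k, i < k → k ≤ j → G.Adj (p k) (p (k - 1)) := fun k h1 h2 => by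
    have := (hadj (k - 1) (by omega) (by omega)).symm
    rwa [show k - 1 + 1 = k by omega] at this
  refine hG p (Finset.Icc i j) (fun _ => 1) (by simpa using hp)
    ⟨i, by simp; omega, one_ne_zero⟩ fun a ha => ?_
  rw [Finset.mem_Icc] at ha
  have key : ∀ b c, b ≠ c → b ∈ Finset.Icc i j → c ∈ Finset.Icc i j → G.Adj (p a) (p b) →
      G.Adj (p a) (p c) → ∃ N ⊆ Finset.Icc i j, (∀ b ∈ N, G.Adj (p a) (p b)) ∧
        2 * 1 ≤ ∑ b ∈ N, 1 := fun b c hbc hb hc h1 h2 =>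
    ⟨{b, c}, by simp [Finset.insert_subset_iff, hb, hc], by simp [h1, h2], by simp [hbc]⟩
  rcases eq_or_ne a i with rfl | h1
  · exact key (a + 1) j (by omega) (by simp; omega) (by simp; omega)
      (hadj a (by omega) (by omega)) h
  rcases eq_or_ne a j with rfl | h2
  · exact key (a - 1) i (by omega) (by simp; omega) (by simp; omega)
      (hprev a (by omega) (by omega)) h.symm
  · exact key (a - 1) (a + 1) (by omega) (by simp; omega) (by simp; omega)
      (hprev a (by omega) (by omega)) (hadj a (by omega) (by omega))

theorem adj_iff (hG : G.NoSubharmonicWeights) (hp : G.IsPathSeq p n) (hi : i ≤ n) (hj : j ≤ n) :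
    G.Adj (p i) (p j) ↔ j = i + 1 ∨ i = j + 1 := by
  have aux : ∀ a b, a ≤ b → b ≤ n → G.Adj (p a) (p b) → b = a + 1 := fun a b hab hb h => by
    by_contra hne
    have : a ≠ b := fun h' => G.loopless.irrefl _ (h' ▸ h)
    exact hG.not_adj_of_injOn (by omega) (hp.1.mono fun k hk => hk.2.trans hb)
      (fun k _ hk => hp.2 k (by omega)) h
  constructor
  · intro h
    rcases le_total i j with hij | hij
    · exact Or.inl (aux i j hij hj h)
    · exact Or.inr (aux j i hij hi h.symm)
  · rintro (rfl | rfl)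
    · exact hp.2 i (by omega)
    · exact (hp.2 j (by omega)).symm

theorem eq_of_adj (hG : G.NoSubharmonicWeights) (hp : G.IsPathSeq p n) (hq : ∀ k ≤ n, p k ≠ q)
    (hi : i ≤ n) (hj : j ≤ n) (h1 : G.Adj q (p i)) (h2 : G.Adj q (p j)) : i = j := by
  have aux : ∀ a b, a < b → b ≤ n → G.Adj q (p a) → ¬ G.Adj q (p b) := fun a b hab hb ha hbq => by
    refine hG.not_adj_of_injOn (p := snocSeq p b q) (i := a) (j := b + 1) (by omega)
      ((injOn_snocSeq (hp.1.mono fun k hk => le_trans hk hb) fun k hk => hq k (hk.trans hb)).mono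
        fun k hk => hk.2) (fun k _ hk => ?_) ?_
    · rcases eq_or_ne k b with rfl | hkb
      · rw [snocSeq_of_le le_rfl, snocSeq_succ]
        exact hbq.symm
      · rw [snocSeq_of_le (by omega), snocSeq_of_le (by omega)]
        exact hp.2 k (by omega)
    · rw [snocSeq_of_le (by omega), snocSeq_succ]
      exact ha.symm
  rcases lt_trichotomy i j with h | h | h
  · exact (aux i j h hj h1 h2).elim
  · exact h
  · exact (aux j i h hi h2 h1).elim

theorem not_affineD (hG : G.NoSubharmonicWeights) (hp : G.IsPathSeq p n)
    (hq : ∀ k ≤ n, p k ≠ q) (hr : ∀ k ≤ n, p k ≠ r) (hqr : q ≠ r) (hi : 0 < i) (hij : i ≤ j)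
    (hj : j < n) (h1 : G.Adj (p i) q) : ¬ G.Adj (p j) r := by
  intro h2
  set φ := snocSeq (snocSeq p n q) (n + 1) r with hφ
  have e1 : ∀ k ≤ n, φ k = p k := fun k hk => by
    rw [hφ, snocSeq_of_le (by omega), snocSeq_of_le hk]
  have e2 : φ (n + 1) = q := by rw [hφ, snocSeq_of_le le_rfl, snocSeq_succ]
  have e3 : φ (n + 2) = r := snocSeq_succ
  have hadj : ∀ k < n, G.Adj (φ k) (φ (k + 1)) := fun k hk => by
    rw [e1 _ (by omega), e1 _ (by omega)]; exact hp.2 k hk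
  have hinj : Set.InjOn φ (Set.Iic (n + 2)) := injOn_snocSeq (injOn_snocSeq hp.1 hq) fun k hk => by
    unfold snocSeq
    split_ifs with h
    · exact hr k h
    · exact hqr
  rw [← e1 i (by omega), ← e2] at h1
  rw [← e1 j (by omega), ← e3] at h2
  have hprev : ∀ k, 0 < k → k ≤ n → G.Adj (φ k) (φ (k - 1)) := fun k h1 h2 => by
    have := (hadj (k - 1) (by omega)).symm
    rwa [show k - 1 + 1 = k by omega] at this
  clear_value φ
  refine hG φ (Finset.range (n + 3))
    (fun k => if i ≤ k ∧ k ≤ j then 2 else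
      if k + 1 = i ∨ k = j + 1 ∨ k = n + 1 ∨ k = n + 2 then 1 else 0)
    (hinj.mono fun k hk => by simp at hk ⊢; omega) ⟨i, by simp; omega, by simp [hij]⟩
    fun a ha => ?_
  rw [Finset.mem_range] at ha
  have hi1 := hprev i hi (by omega)
  have hj1 := hadj j hj
  have ha1 := hprev a
  have ha2 := hadj a
  clear hG hp hq hr e1 e2 e3 hinj hadj hprev
  by_cases hij' : i = j ∧ a = i
  · obtain ⟨rfl, rfl⟩ := hij'
    refine ⟨{a - 1, a + 1, n + 1, n + 2}, by grind, by grind, ?_⟩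
    rw [Finset.sum_insert (by grind), Finset.sum_insert (by grind), Finset.sum_pair (by grind)]
    grind
  by_cases hai : a = i
  · subst hai
    refine ⟨{a - 1, a + 1, n + 1}, by grind, by grind, ?_⟩
    rw [Finset.sum_insert (by grind), Finset.sum_pair (by grind)]
    grind
  by_cases haj : a = j
  · subst haj
    refine ⟨{a - 1, a + 1, n + 2}, by grind, by grind, ?_⟩
    rw [Finset.sum_insert (by grind), Finset.sum_pair (by grind)]
    grind
  by_cases haij : i ≤ a ∧ a ≤ j
  · refine ⟨{a - 1, a + 1}, by grind, by grind, ?_⟩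
    rw [Finset.sum_pair (by grind)]
    grind
  by_cases hai' : a + 1 = i
  · exact ⟨{i}, by grind, by grind, by grind⟩
  by_cases haj' : a = j + 1
  · exact ⟨{j}, by grind, by simpa [haj'] using hj1.symm, by grind⟩
  by_cases haq : a = n + 1
  · exact ⟨{i}, by grind, by simpa [haq] using h1.symm, by grind⟩
  by_cases har : a = n + 2
  · exact ⟨{j}, by grind, by simpa [har] using h2.symm, by grind⟩
  · exact ⟨∅, by simp, by simp, by grind⟩

theorem not_affineE₆ (hG : G.NoSubharmonicWeights) (hp : G.IsPathSeq p n)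
    (hq : ∀ k ≤ n, p k ≠ q) (hr : ∀ k ≤ n, p k ≠ r) (hin : i + 4 ≤ n)
    (h1 : G.Adj (p (i + 2)) q) : ¬ G.Adj q r := by
  intro h2
  set φ := snocSeq (snocSeq p n q) (n + 1) r with hφ
  have e1 : ∀ k ≤ n, φ k = p k := fun k hk => by
    rw [hφ, snocSeq_of_le (by omega), snocSeq_of_le hk]
  have e2 : φ (n + 1) = q := by rw [hφ, snocSeq_of_le le_rfl, snocSeq_succ]
  have e3 : φ (n + 2) = r := snocSeq_succ
  have hadj : ∀ k < n, G.Adj (φ k) (φ (k + 1)) := fun k hk => by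
    rw [e1 _ (by omega), e1 _ (by omega)]; exact hp.2 k hk
  have hinj : Set.InjOn φ (Set.Iic (n + 2)) := injOn_snocSeq (injOn_snocSeq hp.1 hq) fun k hk => by
    unfold snocSeq
    split_ifs with h
    · exact hr k h
    · exact h2.ne
  rw [← e1 _ (by omega), ← e2] at h1
  rw [← e2, ← e3] at h2
  clear_value φ
  refine hG φ {i, i + 1, i + 2, i + 3, i + 4, n + 1, n + 2}
    (fun k => if k = n + 1 then 2 else if k = n + 2 then 1 else min (k + 1 - i) (i + 5 - k))
    (hinj.mono fun k hk => by simp at hk ⊢; omega) ⟨n + 1, by simp, by simp⟩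
    fun a ha => ?_
  have g0 := hadj i (by omega)
  have g1 := hadj (i + 1) (by omega)
  have g2 := hadj (i + 2) (by omega)
  have g3 := hadj (i + 3) (by omega)
  clear hG hp hq hr e1 e2 e3 hinj hadj
  simp only [Finset.mem_insert, Finset.mem_singleton] at ha
  rcases ha with rfl | rfl | rfl | rfl | rfl | rfl | rfl
  · exact ⟨{a + 1}, by simp, by simpa using g0, by grind⟩
  · exact ⟨{i, i + 2}, by simp [Finset.insert_subset_iff], by simpa using ⟨g0.symm, g1⟩,
      by rw [Finset.sum_pair (by omega)]; grind⟩
  · exact ⟨{i + 1, i + 3, n + 1}, by simp [Finset.insert_subset_iff],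
      by simpa using ⟨g1.symm, g2, h1⟩,
      by rw [Finset.sum_insert (by grind), Finset.sum_pair (by omega)]; grind⟩
  · exact ⟨{i + 2, i + 4}, by simp [Finset.insert_subset_iff], by simpa using ⟨g2.symm, g3⟩,
      by rw [Finset.sum_pair (by omega)]; grind⟩
  · exact ⟨{i + 3}, by simp, by simpa using g3.symm, by grind⟩
  · exact ⟨{i + 2, n + 2}, by simp [Finset.insert_subset_iff], by simpa using ⟨h1.symm, h2⟩,
      by rw [Finset.sum_pair (by omega)]; grind⟩
  · exact ⟨{n + 1}, by simp, by simpa using h2.symm, by grind⟩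

theorem not_affineE₇ (hG : G.NoSubharmonicWeights) (hp : G.IsPathSeq p n)
    (hq : ∀ k ≤ n, p k ≠ q) (hin : i + 6 ≤ n) : ¬ G.Adj (p (i + 3)) q := by
  intro h1
  set φ := snocSeq p n q with hφ
  have e1 : ∀ k ≤ n, φ k = p k := fun k hk => snocSeq_of_le hk
  have e2 : φ (n + 1) = q := snocSeq_succ
  have hadj : ∀ k < n, G.Adj (φ k) (φ (k + 1)) := fun k hk => by
    rw [e1 _ (by omega), e1 _ (by omega)]; exact hp.2 k hk
  have hinj : Set.InjOn φ (Set.Iic (n + 1)) := injOn_snocSeq hp.1 hq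
  rw [← e1 _ (by omega), ← e2] at h1
  clear_value φ
  refine hG φ {i, i + 1, i + 2, i + 3, i + 4, i + 5, i + 6, n + 1}
    (fun k => if k = n + 1 then 2 else min (k + 1 - i) (i + 7 - k))
    (hinj.mono fun k hk => by simp at hk ⊢; omega) ⟨n + 1, by simp, by simp⟩
    fun a ha => ?_
  have g0 := hadj i (by omega)
  have g1 := hadj (i + 1) (by omega)
  have g2 := hadj (i + 2) (by omega)
  have g3 := hadj (i + 3) (by omega)
  have g4 := hadj (i + 4) (by omega)
  have g5 := hadj (i + 5) (by omega)
  clear hG hp hq e1 e2 hinj hadj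
  simp only [Finset.mem_insert, Finset.mem_singleton] at ha
  rcases ha with rfl | rfl | rfl | rfl | rfl | rfl | rfl | rfl
  · exact ⟨{a + 1}, by simp, by simpa using g0, by grind⟩
  · exact ⟨{i, i + 2}, by simp [Finset.insert_subset_iff], by simpa using ⟨g0.symm, g1⟩,
      by rw [Finset.sum_pair (by omega)]; grind⟩
  · exact ⟨{i + 1, i + 3}, by simp [Finset.insert_subset_iff], by simpa using ⟨g1.symm, g2⟩,
      by rw [Finset.sum_pair (by omega)]; grind⟩
  · exact ⟨{i + 2, i + 4, n + 1}, by simp [Finset.insert_subset_iff],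
      by simpa using ⟨g2.symm, g3, h1⟩,
      by rw [Finset.sum_insert (by grind), Finset.sum_pair (by omega)]; grind⟩
  · exact ⟨{i + 3, i + 5}, by simp [Finset.insert_subset_iff], by simpa using ⟨g3.symm, g4⟩,
      by rw [Finset.sum_pair (by omega)]; grind⟩
  · exact ⟨{i + 4, i + 6}, by simp [Finset.insert_subset_iff], by simpa using ⟨g4.symm, g5⟩,
      by rw [Finset.sum_pair (by omega)]; grind⟩
  · exact ⟨{i + 5}, by simp, by simpa using g5.symm, by grind⟩
  · exact ⟨{i + 3}, by simp, by simpa using h1.symm, by grind⟩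

theorem not_affineE₈ (hG : G.NoSubharmonicWeights) (hp : G.IsPathSeq p n)
    (hq : ∀ k ≤ n, p k ≠ q) (hn : 7 ≤ n) : ¬ G.Adj (p 2) q := by
  intro h1
  set φ := snocSeq p n q with hφ
  have e1 : ∀ k ≤ n, φ k = p k := fun k hk => snocSeq_of_le hk
  have e2 : φ (n + 1) = q := snocSeq_succ
  have hadj : ∀ k < n, G.Adj (φ k) (φ (k + 1)) := fun k hk => by
    rw [e1 _ (by omega), e1 _ (by omega)]; exact hp.2 k hk
  have hinj : Set.InjOn φ (Set.Iic (n + 1)) := injOn_snocSeq hp.1 hq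
  rw [← e1 _ (by omega), ← e2] at h1
  clear_value φ
  refine hG φ {0, 1, 2, 3, 4, 5, 6, 7, n + 1}
    (fun k => if k = n + 1 then 3 else min (2 * (k + 1)) (8 - k))
    (hinj.mono fun k hk => by simp at hk ⊢; omega) ⟨n + 1, by simp, by simp⟩
    fun a ha => ?_
  have g0 := hadj 0 (by omega)
  have g1 := hadj 1 (by omega)
  have g2 := hadj 2 (by omega)
  have g3 := hadj 3 (by omega)
  have g4 := hadj 4 (by omega)
  have g5 := hadj 5 (by omega)
  have g6 := hadj 6 (by omega)
  clear hG hp hq e1 e2 hinj hadj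
  simp only [Finset.mem_insert, Finset.mem_singleton] at ha
  rcases ha with rfl | rfl | rfl | rfl | rfl | rfl | rfl | rfl | rfl
  · exact ⟨{1}, by simp, by simpa using g0, by grind⟩
  · exact ⟨{0, 2}, by simp [Finset.insert_subset_iff], by simpa using ⟨g0.symm, g1⟩,
      by rw [Finset.sum_pair (by omega)]; grind⟩
  · exact ⟨{1, 3, n + 1}, by simp [Finset.insert_subset_iff],
      by simpa using ⟨g1.symm, g2, h1⟩,
      by rw [Finset.sum_insert (by grind), Finset.sum_pair (by omega)]; grind⟩
  · exact ⟨{2, 4}, by simp [Finset.insert_subset_iff], by simpa using ⟨g2.symm, g3⟩,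
      by rw [Finset.sum_pair (by omega)]; grind⟩
  · exact ⟨{3, 5}, by simp [Finset.insert_subset_iff], by simpa using ⟨g3.symm, g4⟩,
      by rw [Finset.sum_pair (by omega)]; grind⟩
  · exact ⟨{4, 6}, by simp [Finset.insert_subset_iff], by simpa using ⟨g4.symm, g5⟩,
      by rw [Finset.sum_pair (by omega)]; grind⟩
  · exact ⟨{5, 7}, by simp [Finset.insert_subset_iff], by simpa using ⟨g5.symm, g6⟩,
      by rw [Finset.sum_pair (by omega)]; grind⟩
  · exact ⟨{6}, by simp, by simpa using g6.symm, by grind⟩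
  · exact ⟨{2}, by simp, by simpa using h1.symm, by grind⟩

theorem nonempty_iso_pathG (hG : G.NoSubharmonicWeights) (hp : G.IsPathSeq p n)
    (hsurj : ∀ v, ∃ k ≤ n, p k = v) : Nonempty (G ≃g pathG (n + 1)) := by
  have hbij : Function.Bijective fun k : Fin (n + 1) => p k :=
    ⟨fun a b hab => Fin.ext (hp.inj (by omega) (by omega) hab), fun v => by
      obtain ⟨k, hk, rfl⟩ := hsurj v
      exact ⟨⟨k, by omega⟩, rfl⟩⟩
  refine ⟨RelIso.symm ⟨Equiv.ofBijective _ hbij, fun {a b} => ?_⟩⟩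
  simp only [Equiv.ofBijective_apply, pathG, fromRel_adj, ne_eq, Fin.ext_iff]
  rw [hG.adj_iff hp (by omega) (by omega)]
  omega

theorem nonempty_iso_branchG (hG : G.NoSubharmonicWeights) (hp : G.IsPathSeq p n)
    (hq : ∀ k ≤ n, p k ≠ q) (hi : i ≤ n) (h : G.Adj (p i) q)
    (hsurj : ∀ v, (∃ k ≤ n, p k = v) ∨ v = q) : Nonempty (G ≃g branchG (n + 2) i) := by
  have hbij : Function.Bijective fun k : Fin (n + 2) => snocSeq p n q k := by
    refine ⟨fun a b hab => Fin.ext (injOn_snocSeq hp.1 hq ?_ ?_ hab), fun v => ?_⟩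
    · simp; omega
    · simp; omega
    · obtain ⟨k, hk, rfl⟩ | rfl := hsurj v
      · exact ⟨⟨k, by omega⟩, snocSeq_of_le hk⟩
      · exact ⟨⟨n + 1, by omega⟩, snocSeq_succ⟩
  have hqadj : ∀ k ≤ n, G.Adj q (p k) ↔ k = i := fun k hk =>
    ⟨fun hk' => hG.eq_of_adj hp hq hk hi hk' h.symm, by rintro rfl; exact h.symm⟩
  refine ⟨RelIso.symm ⟨Equiv.ofBijective _ hbij, fun {a b} => ?_⟩⟩
  simp only [Equiv.ofBijective_apply, branchG, fromRel_adj, ne_eq, Fin.ext_iff, snocSeq]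
  have := a.2
  have := b.2
  split_ifs with ha hb hb
  · rw [hG.adj_iff hp ha hb]
    omega
  · rw [G.adj_comm, hqadj _ ha]
    omega
  · rw [hqadj _ hb]
    omega
  · simp only [SimpleGraph.irrefl, false_iff]
    omega

end NoSubharmonicWeights

theorem IsPathSeq.not_adj_zero {p : ℕ → V} {n : ℕ} {q : V} (hp : G.IsPathSeq p n)
    (hmax : ∀ p', ¬ G.IsPathSeq p' (n + 1)) (hq : ∀ k ≤ n, p k ≠ q) : ¬ G.Adj (p 0) q :=
  fun h => hmax _ (hp.cons hq h.symm)

theorem IsPathSeq.not_adj_one {p : ℕ → V} {n : ℕ} {q r : V} (hp : G.IsPathSeq p n)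
    (hmax : ∀ p', ¬ G.IsPathSeq p' (n + 1)) (hq : ∀ k ≤ n, p k ≠ q) (hr : ∀ k ≤ n, p k ≠ r)
    (hqr : G.Adj q r) : ¬ G.Adj (p 1) q := fun h => by
  refine (hp.update_zero hq h.symm).not_adj_zero hmax (q := r) (fun k hk => ?_) (by simpa using hqr)
  rcases k with _ | k
  · simpa using hqr.ne
  · simpa using hr _ hk

/-- If a longest path misses a vertex, then `G` is that path with one extra vertex attached. -/
theorem NoSubharmonicWeights.exists_branch (hG : G.NoSubharmonicWeights) (hconn : G.Connected)
    {p : ℕ → V} {n : ℕ} (hp : G.IsPathSeq p n) (hmax : ∀ p', ¬ G.IsPathSeq p' (n + 1))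
    (hne : ¬ ∀ v, ∃ k ≤ n, p k = v) :
    ∃ q i, 0 < i ∧ i < n ∧ (∀ k ≤ n, p k ≠ q) ∧ G.Adj (p i) q ∧
      ∀ v, (∃ k ≤ n, p k = v) ∨ v = q := by
  push Not at hne
  obtain ⟨w, hw⟩ := hne
  have hmid : ∀ i ≤ n, ∀ r, (∀ k ≤ n, p k ≠ r) → G.Adj (p i) r → 0 < i ∧ i < n := by
    intro i hi r hr h
    constructor <;> by_contra hcon
    · obtain rfl : i = 0 := by omega
      exact hp.not_adj_zero hmax hr h
    · obtain rfl : i = n := by omega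
      exact hp.reverse.not_adj_zero hmax (fun k _ => hr _ (by omega)) (by simpa using h)
  obtain ⟨x, ⟨i, hi, rfl⟩, q, hq, hiq⟩ := hconn.exists_adj_notMem
    (S := {v | ∃ k ≤ n, p k = v}) (u := p 0) (w := w) ⟨0, by omega, rfl⟩
    (by simpa using hw)
  replace hq : ∀ k ≤ n, p k ≠ q := by simpa using hq
  obtain ⟨hi0, hin⟩ := hmid i hi q hq hiq
  refine ⟨q, i, hi0, hin, hq, hiq, ?_⟩
  by_contra! hcon
  obtain ⟨w', hw', hw'q⟩ := hcon
  obtain ⟨x, hx, r, hrS, hxr⟩ := hconn.exists_adj_notMem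
    (S := {v | (∃ k ≤ n, p k = v) ∨ v = q}) (u := p 0) (w := w') (Or.inl ⟨0, by omega, rfl⟩)
    (by simpa using ⟨hw', hw'q⟩)
  obtain ⟨hr, hrq⟩ : (∀ k ≤ n, p k ≠ r) ∧ r ≠ q := by simpa using hrS
  rcases hx with ⟨j, hj, rfl⟩ | rfl
  · obtain ⟨hj0, hjn⟩ := hmid j hj r hr hxr
    rcases le_total i j with hij | hij
    · exact hG.not_affineD hp hq hr hrq.symm hi0 hij hjn hiq hxr
    · exact hG.not_affineD hp hr hq hrq hj0 hij hin hxr hiq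
  · have h1 : i ≠ 1 := by
      rintro rfl
      exact hp.not_adj_one hmax hq hr hxr hiq
    have h2 : i + 1 ≠ n := by
      rintro rfl
      exact hp.reverse.not_adj_one hmax (fun k _ => hq _ (by omega)) (fun k _ => hr _ (by omega))
        hxr (by simpa using hiq)
    obtain ⟨i, rfl⟩ : ∃ i', i = i' + 2 := ⟨i - 2, by omega⟩
    exact hG.not_affineE₆ hp hq hr (by omega) hiq hxr

theorem NoSubharmonicWeights.dynkin_of_branch (hG : G.NoSubharmonicWeights)
    {p : ℕ → V} {n i : ℕ} {q : V} (hp : G.IsPathSeq p n) (hi : 0 < i) (hin : 2 * i ≤ n)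
    (hq : ∀ k ≤ n, p k ≠ q) (hiq : G.Adj (p i) q) (hsurj : ∀ v, (∃ k ≤ n, p k = v) ∨ v = q) :
    (∃ m, 4 ≤ m ∧ Nonempty (G ≃g DynkinD m)) ∨
    Nonempty (G ≃g DynkinE 6) ∨ Nonempty (G ≃g DynkinE 7) ∨
    Nonempty (G ≃g DynkinE 8) := by
  obtain rfl | rfl | h3 : i = 1 ∨ i = 2 ∨ 3 ≤ i := by omega
  · refine Or.inl ⟨n + 2, by omega, ?_⟩
    refine hG.nonempty_iso_branchG (q := q) hp.reverse (fun k _ => hq _ (by omega)) (by omega) ?_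
      fun v => (hsurj v).imp_left ?_
    · rwa [show n - (n + 2 - 3) = 1 by omega]
    · rintro ⟨k, hk, rfl⟩
      exact ⟨n - k, by omega, by rw [show n - (n - k) = k by omega]⟩
  · have hiso := hG.nonempty_iso_branchG hp hq (by omega) hiq hsurj
    have h7 : n < 7 := by
      by_contra h7
      exact hG.not_affineE₈ hp hq (by omega) hiq
    obtain rfl | rfl | rfl : n = 4 ∨ n = 5 ∨ n = 6 := by omega
    · exact Or.inr (Or.inl hiso)
    · exact Or.inr (Or.inr (Or.inl hiso))
    · exact Or.inr (Or.inr (Or.inr hiso))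
  · obtain ⟨i, rfl⟩ : ∃ i', i = i' + 3 := ⟨i - 3, by omega⟩
    exact (hG.not_affineE₇ hp hq (by omega) hiq).elim

end SimpleGraph

/-- Every connected finite graph all of whose adjacency eigenvalues have absolute
value strictly less than `2` is a simply-laced Dynkin diagram (type `A`, `D`,
`E₆`, `E₇` or `E₈`). -/
theorem eigenvalues_lt_two_imp_ADE {V : Type*} [Fintype V] [DecidableEq V]
    (G : SimpleGraph V) [DecidableRel G.Adj] (hconn : G.Connected)
    (heig : ∀ α : ℝ, (∃ v : V → ℝ, v ≠ 0 ∧ (G.adjMatrix ℝ).mulVec v = α • v) → |α| < 2) :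
    (∃ m, 1 ≤ m ∧ Nonempty (G ≃g pathG m)) ∨
    (∃ m, 4 ≤ m ∧ Nonempty (G ≃g DynkinD m)) ∨
    Nonempty (G ≃g DynkinE 6) ∨ Nonempty (G ≃g DynkinE 7) ∨
    Nonempty (G ≃g DynkinE 8) := by
  classical
  have hG := SimpleGraph.noSubharmonicWeights_of_eigenvalues heig
  have := hconn.nonempty
  obtain ⟨p, n, hp, hmax⟩ := G.exists_isPathSeq_maximal
  by_cases hall : ∀ v, ∃ k ≤ n, p k = v
  · exact Or.inl ⟨n + 1, by omega, hG.nonempty_iso_pathG hp hall⟩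
  obtain ⟨q, i, hi0, hin, hq, hiq, hsurj⟩ := hG.exists_branch hconn hp hmax hall
  refine Or.inr ?_
  rcases le_total (2 * i) n with h | h
  · exact hG.dynkin_of_branch hp hi0 h hq hiq hsurj
  · refine hG.dynkin_of_branch (i := n - i) hp.reverse (by omega) (by omega)
      (fun k _ => hq _ (by omega)) ?_ fun v => (hsurj v).imp_left ?_
    · rwa [show n - (n - i) = i by omega]
    · rintro ⟨k, hk, rfl⟩
      exact ⟨n - k, by omega, by rw [show n - (n - k) = k by omega]⟩
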